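/- arXiv:0704.2458 — 2 statements merged into one kernel-verified Lean document; each statement's English description precedes it below -/
import Mathlib

section
/- Cyclical monotonicity characterization of optimality: a coupling Σ of λ and ν is optimal for the quadratic cost c(x,y)=‖x−y‖² if and only if for every finite family (x₁,y₁),…,(x_ℓ,y_ℓ) in the support of Σ and every permutation σ of {1,…,ℓ}, ∑ᵢ ‖xᵢ − y_{σ(i)}‖² ≥ ∑ᵢ ‖xᵢ − yᵢ‖². -/
open MeasureTheory ENNReal Filter Topology Pointwise
open scoped Classical

noncomputable section

variable {H : Type*} [NormedAddCommGroup H] [InnerProductSpace ℝ H]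
  [CompleteSpace H] [SecondCountableTopology H] [MeasurableSpace H] [BorelSpace H]

/-- A coupling of `μ` and `ν`: a measure on `H × H` with marginals `μ` and `ν`. -/
def IsCoupling (P : Measure (H × H)) (μ ν : Measure H) : Prop :=
  P.map Prod.fst = μ ∧ P.map Prod.snd = ν

/-- Squared 2-Wasserstein distance, as an infimum of quadratic transport costs. -/
noncomputable def W2sq (μ ν : Measure H) : ℝ≥0∞ :=
  ⨅ (P : Measure (H × H)) (_ : IsCoupling P μ ν),
    ∫⁻ p, ENNReal.ofReal (‖p.1 - p.2‖ ^ 2) ∂P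

/-- Finite second moment. -/
def HasFiniteSecondMoment (μ : Measure H) : Prop :=
  ∫⁻ x, ENNReal.ofReal (‖x‖ ^ 2) ∂μ < ⊤

/-- Membership in the Wasserstein space `P₂(H)`. -/
def MemP2 (μ : Measure H) : Prop :=
  IsProbabilityMeasure μ ∧ HasFiniteSecondMoment μ

/-- Weak convergence of measures, in duality with bounded continuous functions. -/
def WeakConv (μs : ℕ → Measure H) (μ : Measure H) : Prop :=
  ∀ f : BoundedContinuousFunction H ℝ,
    Tendsto (fun n => ∫ x, f x ∂(μs n)) atTop (𝓝 (∫ x, f x ∂μ))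

/-- Relative entropy `H(μ|γ) = ∫ ρ log ρ dγ` if `μ = ργ`, `+∞` otherwise (for probability
measures the integrand satisfies `ρ log ρ + e⁻¹ ≥ 0`, so we compute via `lintegral`). -/
noncomputable def relEnt (μ γ : Measure H) : ℝ≥0∞ :=
  if μ ≪ γ then
    (∫⁻ x, ENNReal.ofReal ((μ.rnDeriv γ x).toReal * Real.log (μ.rnDeriv γ x).toReal
        + Real.exp (-1)) ∂γ) - ENNReal.ofReal (Real.exp (-1))
  else ⊤

/-- The (topological) support of a measure on `H × H`. -/
def msupport (m : Measure (H × H)) : Set (H × H) :=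
  {p | ∀ U : Set (H × H), IsOpen U → p ∈ U → 0 < m U}

set_option linter.unusedSectionVars false

section Marginals

theorem isProbabilityMeasure_of_map_eq {α β : Type*} [MeasurableSpace α] [MeasurableSpace β]
    {μ : Measure α} {ν : Measure β} [IsProbabilityMeasure ν] {f : α → β} (hf : Measurable f)
    (h : μ.map f = ν) : IsProbabilityMeasure μ := by
  subst h
  exact (Measure.isProbabilityMeasure_map_iff hf.aemeasurable).1 inferInstance

theorem msupport_eq_support (P : Measure (H × H)) : msupport P = P.support := by
  ext p
  rw [Measure.mem_support_iff_forall]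
  refine ⟨fun h U hU ↦ ?_, fun h U hU hp ↦ h U (hU.mem_nhds hp)⟩
  obtain ⟨V, hVU, hV, hpV⟩ := mem_nhds_iff.1 hU
  exact (h V hV hpV).trans_le (measure_mono hVU)

theorem ae_mem_msupport (P : Measure (H × H)) : ∀ᵐ p ∂P, p ∈ msupport P := by
  rw [msupport_eq_support]
  exact Measure.support_mem_ae

theorem HasFiniteSecondMoment.memLp {μ : Measure H} (h : HasFiniteSecondMoment μ) :
    MemLp (fun x : H ↦ x) 2 μ := by
  refine ⟨aestronglyMeasurable_id, ?_⟩
  rw [eLpNorm_lt_top_iff_lintegral_rpow_enorm_lt_top (by simp) (by simp)]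
  refine lt_of_eq_of_lt (lintegral_congr fun x ↦ ?_) h
  rw [← ofReal_norm, ENNReal.ofReal_pow (norm_nonneg _)]
  simp

theorem IsCoupling.memLp_fst {P : Measure (H × H)} {μ ν : Measure H} (hP : IsCoupling P μ ν)
    (hμ : HasFiniteSecondMoment μ) : MemLp (fun p : H × H ↦ p.1) 2 P :=
  hμ.memLp.comp_measurePreserving ⟨measurable_fst, hP.1⟩

theorem IsCoupling.memLp_snd {P : Measure (H × H)} {μ ν : Measure H} (hP : IsCoupling P μ ν)
    (hν : HasFiniteSecondMoment ν) : MemLp (fun p : H × H ↦ p.2) 2 P :=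
  hν.memLp.comp_measurePreserving ⟨measurable_snd, hP.2⟩

theorem IsCoupling.integrable_cost {P : Measure (H × H)} {μ ν : Measure H}
    (hP : IsCoupling P μ ν) (hμ : HasFiniteSecondMoment μ) (hν : HasFiniteSecondMoment ν) :
    Integrable (fun p : H × H ↦ ‖p.1 - p.2‖ ^ 2) P :=
  ((hP.memLp_fst hμ).sub (hP.memLp_snd hν)).integrable_norm_pow (by simp)

theorem IsCoupling.integrable_inner {P : Measure (H × H)} {μ ν : Measure H}
    (hP : IsCoupling P μ ν) (hμ : HasFiniteSecondMoment μ) (hν : HasFiniteSecondMoment ν) :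
    Integrable (fun p : H × H ↦ inner ℝ p.1 p.2) P := by
  refine (((hP.memLp_fst hμ).integrable_norm_pow (p := 2) (by simp)).add
    ((hP.memLp_snd hν).integrable_norm_pow (p := 2) (by simp))).mono' (by fun_prop) ?_
  refine ae_of_all _ fun p ↦ (norm_inner_le_norm p.1 p.2).trans ?_
  simp only [Pi.add_apply]
  nlinarith [sq_nonneg (‖p.1‖ - ‖p.2‖), sq_nonneg (‖p.1‖ + ‖p.2‖)]

theorem IsCoupling.lintegral_cost_ne_top {P : Measure (H × H)} {μ ν : Measure H}
    (hP : IsCoupling P μ ν) (hμ : HasFiniteSecondMoment μ) (hν : HasFiniteSecondMoment ν) :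
    ∫⁻ p, ENNReal.ofReal (‖p.1 - p.2‖ ^ 2) ∂P ≠ ⊤ :=
  (hP.integrable_cost hμ hν).lintegral_lt_top.ne

theorem IsCoupling.integral_cost {P : Measure (H × H)} {μ ν : Measure H}
    (hP : IsCoupling P μ ν) (hμ : HasFiniteSecondMoment μ) (hν : HasFiniteSecondMoment ν) :
    ∫ p, ‖p.1 - p.2‖ ^ 2 ∂P =
      ∫ x, ‖x‖ ^ 2 ∂μ - 2 * ∫ p, inner ℝ p.1 p.2 ∂P + ∫ y, ‖y‖ ^ 2 ∂ν := by
  have h₁ : ∫ x, ‖x‖ ^ 2 ∂μ = ∫ p, ‖p.1‖ ^ 2 ∂P := by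
    rw [← hP.1, integral_map measurable_fst.aemeasurable (by fun_prop)]
  have h₂ : ∫ x, ‖x‖ ^ 2 ∂ν = ∫ p, ‖p.2‖ ^ 2 ∂P := by
    rw [← hP.2, integral_map measurable_snd.aemeasurable (by fun_prop)]
  have i₁ := (hP.memLp_fst hμ).integrable_norm_pow (p := 2) (by simp)
  have i₂ := (hP.memLp_snd hν).integrable_norm_pow (p := 2) (by simp)
  have i₃ := (hP.integrable_inner hμ hν).const_mul 2
  have h₃ := integral_add (i₁.sub i₃) i₂
  simp only [Pi.sub_apply] at h₃
  rw [h₁, h₂, ← integral_const_mul, ← integral_sub i₁ i₃, ← h₃]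
  simp only [norm_sub_sq_real]

end Marginals

section CyclicalMonotonicity

/-- Every finite cycle in `S` satisfies the cyclical monotonicity inequality for the inner
product. -/
def CyclicallyMonotone (S : Set (H × H)) : Prop :=
  ∀ (n : ℕ) (z : Fin n → H × H), (∀ i, z i ∈ S) → ∀ σ : Equiv.Perm (Fin n),
    ∑ i, inner ℝ (z (σ i)).1 (z i).2 ≤ ∑ i, inner ℝ (z i).1 (z i).2

theorem cyclicallyMonotone_of_sum_norm_sub_sq_le {S : Set (H × H)}
    (h : ∀ (ℓ : ℕ) (x y : Fin ℓ → H), (∀ i, (x i, y i) ∈ S) → ∀ σ : Equiv.Perm (Fin ℓ),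
      ∑ i, ‖x i - y i‖ ^ 2 ≤ ∑ i, ‖x i - y (σ i)‖ ^ 2) : CyclicallyMonotone S := by
  intro n z hz σ
  have h₁ := h n (fun i ↦ (z i).1) (fun i ↦ (z i).2) hz σ⁻¹
  have h₂ : ∑ i, ‖(z (σ⁻¹ i)).2‖ ^ 2 = ∑ i, ‖(z i).2‖ ^ 2 :=
    Equiv.sum_comp σ⁻¹ fun i ↦ ‖(z i).2‖ ^ 2
  have h₃ : ∑ i, inner ℝ (z i).1 (z (σ⁻¹ i)).2 = ∑ i, inner ℝ (z (σ i)).1 (z i).2 := by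
    rw [← Equiv.sum_comp σ]
    simp
  simp only [norm_sub_sq_real, Finset.sum_add_distrib, Finset.sum_sub_distrib,
    ← Finset.mul_sum, h₂, h₃] at h₁
  linarith

/-- `MonotoneChain S p₀ p r`: some chain in `S` from `p₀` to `p` has total increment `r`. -/
inductive MonotoneChain (S : Set (H × H)) (p₀ : H × H) : H × H → ℝ → Prop
  | refl : MonotoneChain S p₀ p₀ 0
  | step {p q : H × H} {r : ℝ} : MonotoneChain S p₀ p r → q ∈ S →
      MonotoneChain S p₀ q (r + inner ℝ p.2 (q.1 - p.1))

theorem MonotoneChain.exists_fin {S : Set (H × H)} {p₀ p : H × H} {r : ℝ} (hp₀ : p₀ ∈ S)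
    (h : MonotoneChain S p₀ p r) :
    ∃ (n : ℕ) (z : Fin (n + 1) → H × H), (∀ i, z i ∈ S) ∧ z 0 = p₀ ∧ z (Fin.last n) = p ∧
      ∑ i : Fin n, inner ℝ (z i.castSucc).2 ((z i.succ).1 - (z i.castSucc).1) = r := by
  induction h with
  | refl => exact ⟨0, fun _ ↦ p₀, by simpa using hp₀, rfl, rfl, by simp⟩
  | @step p q r _ hq ih =>
    obtain ⟨n, z, hz, h0, hl, hr⟩ := ih
    refine ⟨n + 1, Fin.snoc z q, fun i ↦ ?_, ?_, by simp, ?_⟩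
    · induction i using Fin.lastCases <;> simp [hq, hz]
    · rw [← Fin.castSucc_zero, Fin.snoc_castSucc, h0]
    · rw [Fin.sum_univ_castSucc]
      simp only [Fin.succ_castSucc, Fin.snoc_castSucc, Fin.succ_last, Fin.snoc_last, hr, hl]

theorem MonotoneChain.add_inner_le_zero {S : Set (H × H)} (hS : CyclicallyMonotone S)
    {p₀ p : H × H} {r : ℝ} (hp₀ : p₀ ∈ S) (h : MonotoneChain S p₀ p r) :
    r + inner ℝ p.2 (p₀.1 - p.1) ≤ 0 := by
  obtain ⟨n, z, hz, h0, hl, hr⟩ := h.exists_fin hp₀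
  have h₁ := hS (n + 1) z hz (finRotate (n + 1))
  rw [Fin.sum_univ_castSucc, Fin.sum_univ_castSucc] at h₁
  have h₂ (i : Fin n) : finRotate (n + 1) i.castSucc = i.succ := by
    ext
    simp
  simp only [h₂, finRotate_last, h0, hl] at h₁
  simp only [inner_sub_right, Finset.sum_sub_distrib] at hr
  simp only [real_inner_comm] at hr
  simp only [real_inner_comm] at h₁
  rw [inner_sub_right, real_inner_comm p₀.1, real_inner_comm p.1]
  linarith

end CyclicalMonotonicity

section Potentials

/-- The supremum of the affine functions `x ↦ ⟪a, x⟫ + c` over `(a, c) ∈ T`. -/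
def supAffine (T : Set (H × ℝ)) (x : H) : EReal :=
  ⨆ t : T, ((inner ℝ t.1.1 x + t.1.2 : ℝ) : EReal)

theorem measurable_supAffine (T : Set (H × ℝ)) : Measurable (supAffine T) := by
  refine (lowerSemicontinuous_iSup fun t ↦ Continuous.lowerSemicontinuous ?_).measurable
  exact continuous_coe_real_ereal.comp (by fun_prop)

theorem le_supAffine {T : Set (H × ℝ)} {t : H × ℝ} (ht : t ∈ T) (x : H) :
    ((inner ℝ t.1 x + t.2 : ℝ) : EReal) ≤ supAffine T x :=
  le_iSup (fun t : T ↦ ((inner ℝ t.1.1 x + t.1.2 : ℝ) : EReal)) ⟨t, ht⟩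

theorem supAffine_le_coe_iff {T : Set (H × ℝ)} {x : H} {c : ℝ} :
    supAffine T x ≤ c ↔ ∀ t ∈ T, inner ℝ t.1 x + t.2 ≤ c := by
  simp [supAffine, iSup_le_iff, -EReal.coe_add]

/-- **Rockafellar's theorem**: a nonempty cyclically monotone set is contained in the contact set
of a pair of convex conjugate functions. -/
theorem CyclicallyMonotone.exists_potentials {S : Set (H × H)} (hS : CyclicallyMonotone S)
    (hne : S.Nonempty) : ∃ T T' : Set (H × ℝ), T.Nonempty ∧ T'.Nonempty ∧
      (∀ x y (u v : ℝ), supAffine T x ≤ u → supAffine T' y ≤ v → inner ℝ x y ≤ u + v) ∧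
      ∀ p ∈ S, ∃ u v : ℝ, supAffine T p.1 = u ∧ supAffine T' p.2 = v ∧
        u + v = inner ℝ p.1 p.2 := by
  obtain ⟨p₀, hp₀⟩ := hne
  set T : Set (H × ℝ) :=
    {t | ∃ p r, MonotoneChain S p₀ p r ∧ t = (p.2, r - inner ℝ p.2 p.1)} with hT
  set T' : Set (H × ℝ) := {t | supAffine T t.1 ≤ ((-t.2 : ℝ) : EReal)} with hT'
  have hTne : T.Nonempty := ⟨_, p₀, 0, .refl, rfl⟩
  have hconj (x y : H) (u v : ℝ) (hu : supAffine T x ≤ u) (hv : supAffine T' y ≤ v) :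
      inner ℝ x y ≤ u + v := by
    have := supAffine_le_coe_iff.1 hv (x, -u) (by simpa [hT'] using hu)
    simp only at this
    linarith
  have hfin (p : H × H) (hp : p ∈ S) : ∃ u : ℝ, supAffine T p.1 = u := by
    have hle : supAffine T p.1 ≤ ((inner ℝ p.2 (p.1 - p₀.1) : ℝ) : EReal) := by
      rw [supAffine_le_coe_iff]
      rintro _ ⟨q, r, hq, rfl⟩
      have := (hq.step hp).add_inner_le_zero hS hp₀
      simp only [inner_sub_right] at this ⊢
      linarith
    obtain ⟨t, ht⟩ := hTne
    exact ⟨_, (EReal.coe_toReal (ne_top_of_le_ne_top (EReal.coe_ne_top _) hle)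
      (ne_bot_of_le_ne_bot (EReal.coe_ne_bot _) (le_supAffine ht p.1))).symm⟩
  have hcontact (p : H × H) (hp : p ∈ S) (u : ℝ) (hu : supAffine T p.1 = u) :
      supAffine T' p.2 = ((inner ℝ p.1 p.2 - u : ℝ) : EReal) := by
    apply le_antisymm
    · rw [supAffine_le_coe_iff]
      rintro ⟨x, c⟩ hx
      have hsub : supAffine T p.1 ≤ ((-c - inner ℝ p.2 (x - p.1) : ℝ) : EReal) := by
        rw [supAffine_le_coe_iff]
        rintro _ ⟨q, r, hq, rfl⟩
        have := supAffine_le_coe_iff.1 hx _ ⟨p, _, hq.step hp, rfl⟩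
        simp only [inner_sub_right] at this ⊢
        linarith
      rw [hu, EReal.coe_le_coe_iff, inner_sub_right] at hsub
      linarith [real_inner_comm p.1 p.2, real_inner_comm x p.2]
    · have := le_supAffine (T := T') (t := (p.1, -u)) (by simp [hT', hu]) p.2
      simpa [sub_eq_add_neg] using this
  refine ⟨T, T', hTne, ?_, hconj, fun p hp ↦ ?_⟩
  · obtain ⟨u, hu⟩ := hfin p₀ hp₀
    exact ⟨(p₀.1, -u), by simp [hT', hu]⟩
  · obtain ⟨u, hu⟩ := hfin p hp
    exact ⟨u, _, hu, hcontact p hp u hu, by ring⟩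

theorem inner_add_le_toReal_supAffine {T : Set (H × ℝ)} {t : H × ℝ} (ht : t ∈ T) {x : H} {u : ℝ}
    (hx : supAffine T x = u) : inner ℝ t.1 x + t.2 ≤ (supAffine T x).toReal := by
  have := le_supAffine ht x
  rw [hx] at this ⊢
  simpa [-EReal.coe_add] using this

theorem integral_inner_le_of_cyclicallyMonotone {lam ν : Measure H} (hlam : MemP2 lam)
    (hν : MemP2 ν) {P Q : Measure (H × H)} (hP : IsCoupling P lam ν) (hQ : IsCoupling Q lam ν)
    {S : Set (H × H)} (hPS : ∀ᵐ p ∂P, p ∈ S) (hS : CyclicallyMonotone S) :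
    ∫ p, inner ℝ p.1 p.2 ∂Q ≤ ∫ p, inner ℝ p.1 p.2 ∂P := by
  have := hlam.1
  have : IsProbabilityMeasure P := isProbabilityMeasure_of_map_eq measurable_fst hP.1
  obtain ⟨T, T', ⟨t, ht⟩, ⟨t', ht'⟩, hconj, hcontact⟩ := hS.exists_potentials hPS.exists
  have hmT := measurable_supAffine T
  have hmT' := measurable_supAffine T'
  set f : H → ℝ := fun x ↦ (supAffine T x).toReal with hf
  set g : H → ℝ := fun y ↦ (supAffine T' y).toReal with hg
  have hmf : Measurable f := hmT.ereal_toReal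
  have hmg : Measurable g := hmT'.ereal_toReal
  have hfstP : MeasurePreserving Prod.fst P lam := ⟨measurable_fst, hP.1⟩
  have hsndP : MeasurePreserving Prod.snd P ν := ⟨measurable_snd, hP.2⟩
  have hfstQ : MeasurePreserving Prod.fst Q lam := ⟨measurable_fst, hQ.1⟩
  have hsndQ : MeasurePreserving Prod.snd Q ν := ⟨measurable_snd, hQ.2⟩
  have hsum : ∀ᵐ p ∂P, f p.1 + g p.2 = inner ℝ p.1 p.2 ∧ inner ℝ t.1 p.1 + t.2 ≤ f p.1 ∧
      inner ℝ t'.1 p.2 + t'.2 ≤ g p.2 := by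
    filter_upwards [hPS] with p hp
    obtain ⟨u, v, hu, hv, huv⟩ := hcontact p hp
    exact ⟨by simp [hf, hg, hu, hv, huv], inner_add_le_toReal_supAffine ht hu,
      inner_add_le_toReal_supAffine ht' hv⟩
  have i₁ : Integrable (fun p : H × H ↦ inner ℝ t.1 p.1 + t.2) P :=
    (((hP.memLp_fst hlam.2).integrable (by simp)).const_inner t.1).add (integrable_const _)
  have i₂ : Integrable (fun p : H × H ↦ inner ℝ t'.1 p.2 + t'.2) P :=
    (((hP.memLp_snd hν.2).integrable (by simp)).const_inner t'.1).add (integrable_const _)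
  have i₃ := hP.integrable_inner hlam.2 hν.2
  have hfP : Integrable (fun p : H × H ↦ f p.1) P := by
    refine integrable_of_le_of_le (hmf.comp measurable_fst).aestronglyMeasurable ?_ ?_ i₁ (i₃.sub i₂)
    · filter_upwards [hsum] with p hp using hp.2.1
    · filter_upwards [hsum] with p hp
      simp only [Pi.sub_apply]
      linarith [hp.1, hp.2.2]
  have hgP : Integrable (fun p : H × H ↦ g p.2) P := by
    refine (i₃.sub hfP).congr ?_
    filter_upwards [hsum] with p hp
    simp only [Pi.sub_apply]
    linarith [hp.1]
  have hflam : Integrable f lam := (hfstP.integrable_comp hmf.aestronglyMeasurable).1 hfP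
  have hgν : Integrable g ν := (hsndP.integrable_comp hmg.aestronglyMeasurable).1 hgP
  have hfQ : Integrable (fun p : H × H ↦ f p.1) Q :=
    (hfstQ.integrable_comp hmf.aestronglyMeasurable).2 hflam
  have hgQ : Integrable (fun p : H × H ↦ g p.2) Q :=
    (hsndQ.integrable_comp hmg.aestronglyMeasurable).2 hgν
  have hfin : ∀ᵐ x ∂lam, supAffine T x ≤ (f x : EReal) := by
    rw [← hP.1, ae_map_iff measurable_fst.aemeasurable
      (measurableSet_le hmT hmf.coe_real_ereal)]
    filter_upwards [hPS] with p hp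
    obtain ⟨u, v, hu, -, -⟩ := hcontact p hp
    simp [hf, hu]
  have hgfin : ∀ᵐ y ∂ν, supAffine T' y ≤ (g y : EReal) := by
    rw [← hP.2, ae_map_iff measurable_snd.aemeasurable
      (measurableSet_le hmT' hmg.coe_real_ereal)]
    filter_upwards [hPS] with p hp
    obtain ⟨u, v, -, hv, -⟩ := hcontact p hp
    simp [hg, hv]
  calc ∫ p, inner ℝ p.1 p.2 ∂Q ≤ ∫ p, (f p.1 + g p.2) ∂Q := by
        refine integral_mono_ae (hQ.integrable_inner hlam.2 hν.2) (hfQ.add hgQ) ?_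
        filter_upwards [hfstQ.quasiMeasurePreserving.ae hfin,
          hsndQ.quasiMeasurePreserving.ae hgfin] with p h₁ h₂
        exact hconj _ _ _ _ h₁ h₂
    _ = ∫ p, (f p.1 + g p.2) ∂P := by
        rw [integral_add hfQ hgQ, integral_add hfP hgP,
          ← integral_map (f := f) measurable_fst.aemeasurable hmf.aestronglyMeasurable,
          ← integral_map (f := g) measurable_snd.aemeasurable hmg.aestronglyMeasurable,
          ← integral_map (f := f) measurable_fst.aemeasurable hmf.aestronglyMeasurable,
          ← integral_map (f := g) measurable_snd.aemeasurable hmg.aestronglyMeasurable,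
          hP.1, hP.2, hQ.1, hQ.2]
    _ = ∫ p, inner ℝ p.1 p.2 ∂P :=
        integral_congr_ae (hsum.mono fun p hp ↦ hp.1)

theorem lintegral_cost_le_of_cyclicallyMonotone {lam ν : Measure H} (hlam : MemP2 lam)
    (hν : MemP2 ν) {P Q : Measure (H × H)} (hP : IsCoupling P lam ν) (hQ : IsCoupling Q lam ν)
    {S : Set (H × H)} (hPS : ∀ᵐ p ∂P, p ∈ S) (hS : CyclicallyMonotone S) :
    ∫⁻ p, ENNReal.ofReal (‖p.1 - p.2‖ ^ 2) ∂P ≤ ∫⁻ p, ENNReal.ofReal (‖p.1 - p.2‖ ^ 2) ∂Q := by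
  rw [← ofReal_integral_eq_lintegral_ofReal (hP.integrable_cost hlam.2 hν.2)
      (ae_of_all _ fun p ↦ by positivity),
    ← ofReal_integral_eq_lintegral_ofReal (hQ.integrable_cost hlam.2 hν.2)
      (ae_of_all _ fun p ↦ by positivity),
    hP.integral_cost hlam.2 hν.2, hQ.integral_cost hlam.2 hν.2]
  have := integral_inner_le_of_cyclicallyMonotone hlam hν hP hQ hPS hS
  exact ENNReal.ofReal_le_ofReal (by linarith)

end Potentials

section Rearrangement

/-- Every submeasure of an optimal coupling is optimal between its own marginals. -/
theorem lintegral_cost_le_of_le_optimal {P A B : Measure (H × H)} [IsFiniteMeasure A]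
    (hfin : ∫⁻ p, ENNReal.ofReal (‖p.1 - p.2‖ ^ 2) ∂P ≠ ⊤)
    (hopt : ∀ Q : Measure (H × H), Q.map Prod.fst = P.map Prod.fst →
      Q.map Prod.snd = P.map Prod.snd → ∫⁻ p, ENNReal.ofReal (‖p.1 - p.2‖ ^ 2) ∂P ≤
        ∫⁻ p, ENNReal.ofReal (‖p.1 - p.2‖ ^ 2) ∂Q)
    (hA : A ≤ P) (h₁ : B.map Prod.fst = A.map Prod.fst) (h₂ : B.map Prod.snd = A.map Prod.snd) :
    ∫⁻ p, ENNReal.ofReal (‖p.1 - p.2‖ ^ 2) ∂A ≤ ∫⁻ p, ENNReal.ofReal (‖p.1 - p.2‖ ^ 2) ∂B := by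
  have hPA : P - A + A = P := Measure.sub_add_cancel_of_le hA
  have h := hopt (P - A + B)
    (by rw [Measure.map_add _ _ measurable_fst, h₁, ← Measure.map_add _ _ measurable_fst, hPA])
    (by rw [Measure.map_add _ _ measurable_snd, h₂, ← Measure.map_add _ _ measurable_snd, hPA])
  have hfin' : ∫⁻ p, ENNReal.ofReal (‖p.1 - p.2‖ ^ 2) ∂(P - A) ≠ ⊤ :=
    ne_top_of_le_ne_top hfin (lintegral_mono' Measure.sub_le le_rfl)
  conv_lhs at h => rw [← hPA]
  rw [lintegral_add_measure, lintegral_add_measure] at h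
  exact (ENNReal.add_le_add_iff_left hfin').1 h

theorem msupport_cyclicallyMonotone_of_optimal (P : Measure (H × H)) [IsProbabilityMeasure P]
    (hfin : ∫⁻ p, ENNReal.ofReal (‖p.1 - p.2‖ ^ 2) ∂P ≠ ⊤)
    (hopt : ∀ Q : Measure (H × H), Q.map Prod.fst = P.map Prod.fst →
      Q.map Prod.snd = P.map Prod.snd → ∫⁻ p, ENNReal.ofReal (‖p.1 - p.2‖ ^ 2) ∂P ≤
        ∫⁻ p, ENNReal.ofReal (‖p.1 - p.2‖ ^ 2) ∂Q)
    (ℓ : ℕ) (x y : Fin ℓ → H) (hxy : ∀ i, (x i, y i) ∈ msupport P) (σ : Equiv.Perm (Fin ℓ)) :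
    ∑ i, ‖x i - y i‖ ^ 2 ≤ ∑ i, ‖x i - y (σ i)‖ ^ 2 := by
  by_contra! hlt
  have hℓ : ℓ ≠ 0 := by
    rintro rfl
    simp at hlt
  have : Nonempty (Fin ℓ) := ⟨⟨0, Nat.pos_of_ne_zero hℓ⟩⟩
  have hopen : IsOpen {z : Fin ℓ → H × H |
      ∑ i, ‖(z i).1 - (z (σ i)).2‖ ^ 2 < ∑ i, ‖(z i).1 - (z i).2‖ ^ 2} :=
    isOpen_lt (by fun_prop) (by fun_prop)
  obtain ⟨U, hU, hUsub⟩ := isOpen_pi_iff'.1 hopen (fun i ↦ (x i, y i)) hlt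
  have hpos (i : Fin ℓ) : P (U i) ≠ 0 := (hxy i (U i) (hU i).1 (hU i).2).ne'
  have hmeas (i : Fin ℓ) : MeasurableSet (U i) := (hU i).1.measurableSet
  let R (i : Fin ℓ) : Measure (H × H) := ProbabilityTheory.cond P (U i)
  have hR (i : Fin ℓ) : IsProbabilityMeasure (R i) :=
    ProbabilityTheory.cond_isProbabilityMeasure (hpos i)
  obtain ⟨j, -, hj⟩ := Finset.exists_min_image Finset.univ (fun i ↦ P (U i)) Finset.univ_nonempty
  set η : ℝ≥0∞ := P (U j) / ℓ with hη
  have hη0 : η ≠ 0 := ENNReal.div_ne_zero.2 ⟨hpos j, ENNReal.natCast_ne_top ℓ⟩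
  have hηtop : η ≠ ⊤ := ENNReal.div_ne_top (measure_ne_top _ _) (by simpa using hℓ)
  let A : Measure (H × H) := η • ∑ i, R i
  let M : Measure (Fin ℓ → H × H) := Measure.pi R
  let B : Measure (H × H) :=
    η • ∑ i, M.map fun z : Fin ℓ → H × H ↦ ((z i).1, (z (σ i)).2)
  have hmB (i : Fin ℓ) : Measurable fun z : Fin ℓ → H × H ↦ ((z i).1, (z (σ i)).2) := by fun_prop
  have heval (i : Fin ℓ) : M.map (fun z ↦ z i) = R i := (measurePreserving_eval R i).map_eq
  have hAP : A ≤ P := by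
    have hle (i : Fin ℓ) : η • R i ≤ (ℓ : ℝ≥0∞)⁻¹ • P := by
      refine Measure.le_iff.2 fun s _ ↦ ?_
      simp only [R, ProbabilityTheory.cond, Measure.smul_apply, smul_eq_mul, hη, div_eq_mul_inv]
      calc P (U j) * (ℓ : ℝ≥0∞)⁻¹ * ((P (U i))⁻¹ * P.restrict (U i) s)
          ≤ P (U i) * (ℓ : ℝ≥0∞)⁻¹ * ((P (U i))⁻¹ * P s) := by
            exact mul_le_mul' (mul_le_mul_left (hj i (Finset.mem_univ i)) _)
              (mul_le_mul_right (Measure.restrict_apply_le _ _) _)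
        _ = (P (U i) * (P (U i))⁻¹) * ((ℓ : ℝ≥0∞)⁻¹ * P s) := by ring
        _ = (ℓ : ℝ≥0∞)⁻¹ * P s := by
            rw [ENNReal.mul_inv_cancel (hpos i) (measure_ne_top _ _), one_mul]
    calc A = ∑ i, η • R i := Finset.smul_sum
      _ ≤ ∑ _i : Fin ℓ, (ℓ : ℝ≥0∞)⁻¹ • P := Finset.sum_le_sum fun i _ ↦ hle i
      _ = P := by
        rw [Finset.sum_const, Finset.card_univ, Fintype.card_fin, ← Nat.cast_smul_eq_nsmul ℝ≥0∞,
          smul_smul, ENNReal.mul_inv_cancel (by simpa using hℓ) (ENNReal.natCast_ne_top ℓ), one_smul]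
  have hAfin : IsFiniteMeasure A := isFiniteMeasure_of_le P hAP
  have h₁ : B.map Prod.fst = A.map Prod.fst := by
    simp only [A, B, ← Measure.mapₗ_apply_of_measurable measurable_fst]
    rw [map_smul, map_smul, map_sum, map_sum]
    congr 1
    refine Finset.sum_congr rfl fun i _ ↦ ?_
    rw [Measure.mapₗ_apply_of_measurable measurable_fst,
      Measure.mapₗ_apply_of_measurable measurable_fst, Measure.map_map measurable_fst (hmB i),
      ← heval i, Measure.map_map measurable_fst (measurable_pi_apply i)]
    rfl
  have h₂ : B.map Prod.snd = A.map Prod.snd := by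
    simp only [A, B, ← Measure.mapₗ_apply_of_measurable measurable_snd]
    rw [map_smul, map_smul, map_sum, map_sum]
    congr 1
    rw [← Equiv.sum_comp σ fun i ↦ Measure.mapₗ Prod.snd (R i)]
    refine Finset.sum_congr rfl fun i _ ↦ ?_
    rw [Measure.mapₗ_apply_of_measurable measurable_snd,
      Measure.mapₗ_apply_of_measurable measurable_snd, Measure.map_map measurable_snd (hmB i),
      ← heval (σ i), Measure.map_map measurable_snd (measurable_pi_apply (σ i))]
    rfl
  have hcostA : ∫⁻ p, ENNReal.ofReal (‖p.1 - p.2‖ ^ 2) ∂A =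
      η * ∫⁻ z, ENNReal.ofReal (∑ i, ‖(z i).1 - (z i).2‖ ^ 2) ∂M := by
    simp only [ENNReal.ofReal_sum_of_nonneg fun i _ ↦ sq_nonneg _]
    rw [lintegral_smul_measure, lintegral_finsetSum_measure,
      lintegral_finsetSum _ fun i _ ↦ by fun_prop, smul_eq_mul]
    congr 1
    refine Finset.sum_congr rfl fun i _ ↦ ?_
    rw [← heval i, lintegral_map (by fun_prop) (by fun_prop)]
  have hcostB : ∫⁻ p, ENNReal.ofReal (‖p.1 - p.2‖ ^ 2) ∂B =
      η * ∫⁻ z, ENNReal.ofReal (∑ i, ‖(z i).1 - (z (σ i)).2‖ ^ 2) ∂M := by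
    simp only [ENNReal.ofReal_sum_of_nonneg fun i _ ↦ sq_nonneg _]
    rw [lintegral_smul_measure, lintegral_finsetSum_measure,
      lintegral_finsetSum _ fun i _ ↦ by fun_prop, smul_eq_mul]
    congr 1
    refine Finset.sum_congr rfl fun i _ ↦ ?_
    rw [lintegral_map (by fun_prop) (hmB i)]
  have hae : ∀ᵐ z ∂M, ENNReal.ofReal (∑ i, ‖(z i).1 - (z (σ i)).2‖ ^ 2) <
      ENNReal.ofReal (∑ i, ‖(z i).1 - (z i).2‖ ^ 2) := by
    have hmem : ∀ᵐ z ∂M, ∀ i, z i ∈ U i := by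
      refine ae_all_iff.2 fun i ↦ ?_
      exact (measurePreserving_eval R i).quasiMeasurePreserving.ae
        (ProbabilityTheory.ae_cond_mem (hmeas i))
    filter_upwards [hmem] with z hz
    have hlt' : ∑ i, ‖(z i).1 - (z (σ i)).2‖ ^ 2 < ∑ i, ‖(z i).1 - (z i).2‖ ^ 2 :=
      hUsub fun i _ ↦ hz i
    exact (ENNReal.ofReal_lt_ofReal_iff_of_nonneg
      (Finset.sum_nonneg fun i _ ↦ sq_nonneg _)).2 hlt'
  have hle := lintegral_cost_le_of_le_optimal hfin hopt hAP h₁ h₂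
  have hAtop : ∫⁻ p, ENNReal.ofReal (‖p.1 - p.2‖ ^ 2) ∂A ≠ ⊤ :=
    ne_top_of_le_ne_top hfin (lintegral_mono' hAP le_rfl)
  rw [hcostA] at hAtop
  rw [hcostA, hcostB, ENNReal.mul_le_mul_iff_right hη0 hηtop] at hle
  have hBtop : ∫⁻ z, ENNReal.ofReal (∑ i, ‖(z i).1 - (z (σ i)).2‖ ^ 2) ∂M ≠ ⊤ :=
    ne_top_of_le_ne_top (fun h ↦ hAtop (by rw [h, ENNReal.mul_top hη0]))
      (lintegral_mono_ae (hae.mono fun _ h ↦ h.le))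
  exact (lintegral_strict_mono (IsProbabilityMeasure.ne_zero M) (by fun_prop) hBtop hae).not_ge hle

end Rearrangement

/-- Cyclical monotonicity characterization of optimal couplings for the quadratic cost:
a coupling `P` of `lam` and `ν` is optimal if and only if its support is cyclically
monotone. -/
theorem optimal_iff_cyclicallyMonotone (lam ν : Measure H)
    (hlam : MemP2 lam) (hν : MemP2 ν)
    (P : Measure (H × H)) (hP : IsCoupling P lam ν) :
    (∫⁻ p, ENNReal.ofReal (‖p.1 - p.2‖ ^ 2) ∂P = W2sq lam ν) ↔
      ∀ (ℓ : ℕ) (x y : Fin ℓ → H), (∀ i, (x i, y i) ∈ msupport P) →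
        ∀ σ : Equiv.Perm (Fin ℓ),
          ∑ i, ‖x i - y i‖ ^ 2 ≤ ∑ i, ‖x i - y (σ i)‖ ^ 2 := by
  have := hlam.1
  have : IsProbabilityMeasure P := isProbabilityMeasure_of_map_eq measurable_fst hP.1
  constructor
  · intro hopt
    exact msupport_cyclicallyMonotone_of_optimal P (hP.lintegral_cost_ne_top hlam.2 hν.2)
      fun Q h₁ h₂ ↦ hopt.trans_le (iInf₂_le Q ⟨h₁.trans hP.1, h₂.trans hP.2⟩)
  · intro hcyc
    have hcyc' : CyclicallyMonotone (msupport P) := cyclicallyMonotone_of_sum_norm_sub_sq_le hcyc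
    refine le_antisymm (le_iInf₂ fun Q hQ ↦ ?_) (iInf₂_le P hP)
    exact lintegral_cost_le_of_cyclicallyMonotone hlam hν hP hQ (ae_mem_msupport P) hcyc'
end
end

section
/- Regularizing effect of the entropy gradient flow: if (S[μ̄](t)) is the gradient flow of F(·) = H(·|γ) starting from μ̄ ∈ closure of D(F), then for all t > 0, F(S[μ̄](t)) ≤ inf_{ν ∈ D(F)} { (1/2t) W₂²(μ̄, ν) + F(ν) } < +∞; in particular if γ ∈ P₂(H) then H(S[δ_x](t)|γ) ≤ (1/2t) W₂²(δ_x, γ) for every x in the support of γ. -/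
open MeasureTheory ENNReal Filter Topology Pointwise
open scoped Classical

noncomputable section

variable {H : Type*} [NormedAddCommGroup H] [InnerProductSpace ℝ H]
  [CompleteSpace H] [SecondCountableTopology H] [MeasurableSpace H] [BorelSpace H]

/-- `μ` (defined for positive times) is a gradient flow of `F` in `P₂(H)`: a curve,
continuous in the Wasserstein distance, satisfying for every `ν ∈ D(F)` the evolution
variational inequality `(d/dt)(1/2)W₂²(μ_t,ν) + F(μ_t) ≤ F(ν)` in the sense of
distributions on `]0,∞[`, stated here in the equivalent integrated form. -/
def IsGradientFlow (F : Measure H → ℝ≥0∞) (μ : ℝ → Measure H) : Prop :=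
  (∀ t : ℝ, 0 < t → MemP2 (μ t)) ∧
  (∀ t₀ : ℝ, 0 < t₀ →
    Tendsto (fun t => W2sq (μ t) (μ t₀)) (𝓝[Set.Ioi (0:ℝ)] t₀) (𝓝 0)) ∧
  (∀ ν : Measure H, MemP2 ν → F ν < ⊤ → ∀ s t : ℝ, 0 < s → s ≤ t →
    W2sq (μ t) ν / 2 + ∫⁻ r in Set.Ioc s t, F (μ r) ≤
      W2sq (μ s) ν / 2 + ENNReal.ofReal (t - s) * F ν)

/-- The gradient flow `μ` starts from `μbar`: `μ_t → μbar` in `P₂(H)` as `t ↓ 0`. -/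
def StartsFrom (μ : ℝ → Measure H) (μbar : Measure H) : Prop :=
  Tendsto (fun t => W2sq (μ t) μbar) (𝓝[Set.Ioi (0:ℝ)] 0) (𝓝 0)

/-- Log-concavity of a measure: for all open sets `B, C` and `t ∈ (0,1)`,
`γ((1−t)B + tC) ≥ γ(B)^{1−t} γ(C)^t` (the multiplicative form of
`log γ((1−t)B+tC) ≥ (1−t) log γ(B) + t log γ(C)`). -/
def IsLogConcave (γ : Measure H) : Prop :=
  ∀ B C : Set H, IsOpen B → IsOpen C → ∀ t : ℝ, 0 < t → t < 1 →
    γ B ^ (1 - t) * γ C ^ t ≤ γ ((1 - t) • B + t • C)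

set_option linter.unusedSectionVars false

theorem IsCoupling.isProbabilityMeasure_of_right {P : Measure (H × H)} {μ ν : Measure H}
    [IsProbabilityMeasure ν] (hP : IsCoupling P μ ν) : IsProbabilityMeasure P := by
  constructor
  rw [← measure_univ (μ := ν), ← hP.2, Measure.map_apply measurable_snd .univ, Set.preimage_univ]

theorem IsCoupling.isProbabilityMeasure_of_left {P : Measure (H × H)} {μ ν : Measure H}
    [IsProbabilityMeasure μ] (hP : IsCoupling P μ ν) : IsProbabilityMeasure P := by
  constructor
  rw [← measure_univ (μ := μ), ← hP.1, Measure.map_apply measurable_fst .univ, Set.preimage_univ]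

theorem IsCoupling.swap {P : Measure (H × H)} {μ ν : Measure H} (hP : IsCoupling P μ ν) :
    IsCoupling (P.map Prod.swap) ν μ := by
  refine ⟨?_, ?_⟩ <;> rw [Measure.map_map (by fun_prop) measurable_swap]
  exacts [hP.2, hP.1]

theorem IsCoupling.W2sq_le {P : Measure (H × H)} {μ ν : Measure H} (hP : IsCoupling P μ ν) :
    W2sq μ ν ≤ ∫⁻ p, ENNReal.ofReal (‖p.1 - p.2‖ ^ 2) ∂P :=
  iInf₂_le P hP

theorem W2sq_comm (μ ν : Measure H) : W2sq μ ν = W2sq ν μ := by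
  have key : ∀ μ ν : Measure H, W2sq μ ν ≤ W2sq ν μ := fun μ ν =>
    le_iInf₂ fun P hP => hP.swap.W2sq_le.trans_eq <| by
      rw [lintegral_map (by fun_prop) measurable_swap]
      simp [norm_sub_rev]
  exact le_antisymm (key μ ν) (key ν μ)

theorem W2sq_self (μ : Measure H) : W2sq μ μ = 0 := by
  have hP : IsCoupling (μ.map fun x => (x, x)) μ μ := by
    refine ⟨?_, ?_⟩ <;> rw [Measure.map_map (by fun_prop) (by fun_prop)] <;>
      exact Measure.map_id
  refine le_antisymm (hP.W2sq_le.trans_eq ?_) zero_le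
  rw [lintegral_map (by fun_prop) (by fun_prop)]
  simp

/-- Gluing of two couplings along their common marginal. -/
theorem IsCoupling.exists_glue {P Q : Measure (H × H)} {μ σ ν : Measure H}
    [IsProbabilityMeasure σ] (hP : IsCoupling P σ μ) (hQ : IsCoupling Q σ ν) :
    ∃ R : Measure ((H × H) × H), R.map Prod.fst = Q ∧ R.map (fun p => (p.1.1, p.2)) = P := by
  have hPp := hP.isProbabilityMeasure_of_left
  have hQp := hQ.isProbabilityMeasure_of_left
  refine ⟨Q.compProd (P.condKernel.comap Prod.fst measurable_fst), Measure.fst_compProd _ _, ?_⟩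
  refine Measure.ext_of_lintegral _ fun f hf => ?_
  rw [lintegral_map hf (by fun_prop), Measure.lintegral_compProd (by fun_prop)]
  simp only [ProbabilityTheory.Kernel.comap_apply]
  conv_rhs => rw [← P.disintegrate P.condKernel]
  rw [Measure.lintegral_compProd hf, Measure.fst, hP.1, ← hQ.1, lintegral_map _ measurable_fst]
  exact hf.lintegral_kernel_prod_right'

/-- A quantitative triangle inequality for the squared Wasserstein distance. -/
theorem W2sq_le_add {μ σ ν : Measure H} [IsProbabilityMeasure σ] {ε : ℝ} (hε : 0 < ε) :
    W2sq μ ν ≤ ENNReal.ofReal (1 + ε) * W2sq σ ν + ENNReal.ofReal (1 + ε⁻¹) * W2sq μ σ := by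
  have h1 : 0 < 1 + ε := by positivity
  have h2 : 0 < 1 + ε⁻¹ := by positivity
  rw [W2sq_comm μ σ]
  conv_rhs => unfold W2sq
  simp only [ENNReal.mul_iInf_of_ne (ENNReal.ofReal_pos.2 h1).ne' ENNReal.ofReal_ne_top,
    ENNReal.mul_iInf_of_ne (ENNReal.ofReal_pos.2 h2).ne' ENNReal.ofReal_ne_top,
    ENNReal.iInf_add, ENNReal.add_iInf]
  refine le_iInf fun P => le_iInf fun hP => le_iInf fun Q => le_iInf fun hQ => ?_
  obtain ⟨R, hRQ, hRP⟩ := hP.exists_glue hQ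
  have hR : IsCoupling (R.map fun p => (p.2, p.1.2)) μ ν := by
    refine ⟨?_, ?_⟩ <;> rw [Measure.map_map (by fun_prop) (by fun_prop)]
    · rw [← hP.2, ← hRP, Measure.map_map (by fun_prop) (by fun_prop)]
      rfl
    · rw [← hQ.2, ← hRQ, Measure.map_map (by fun_prop) (by fun_prop)]
      rfl
  refine hR.W2sq_le.trans ?_
  rw [← hRP, ← hRQ, lintegral_map (by fun_prop) (by fun_prop),
    lintegral_map (by fun_prop) (by fun_prop), lintegral_map (by fun_prop) (by fun_prop),
    ← lintegral_const_mul _ (by fun_prop), ← lintegral_const_mul _ (by fun_prop),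
    ← lintegral_add_left (by fun_prop)]
  refine lintegral_mono fun p => ?_
  simp only
  rw [← ENNReal.ofReal_mul h1.le, ← ENNReal.ofReal_mul h2.le,
    ← ENNReal.ofReal_add (by positivity) (by positivity)]
  refine ENNReal.ofReal_le_ofReal ?_
  have h3 : ‖p.2 - p.1.2‖ ≤ ‖p.1.1 - p.1.2‖ + ‖p.1.1 - p.2‖ := by
    rw [norm_sub_rev p.1.1 p.2, add_comm]
    exact norm_sub_le_norm_sub_add_norm_sub _ _ _
  have h4 : 0 ≤ ε⁻¹ * (ε * ‖p.1.1 - p.1.2‖ - ‖p.1.1 - p.2‖) ^ 2 := by positivity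
  have h5 : ε⁻¹ * (ε * ‖p.1.1 - p.1.2‖ - ‖p.1.1 - p.2‖) ^ 2 = ε * ‖p.1.1 - p.1.2‖ ^ 2
      - 2 * ‖p.1.1 - p.1.2‖ * ‖p.1.1 - p.2‖ + ε⁻¹ * ‖p.1.1 - p.2‖ ^ 2 := by
    field_simp
    ring
  have h6 := pow_le_pow_left₀ (norm_nonneg _) h3 2
  nlinarith

/-- Convergence in the Wasserstein distance implies weak convergence. -/
theorem weakConv_of_tendsto_W2sq {μs : ℕ → Measure H} {μ : Measure H}
    (hμs : ∀ n, IsProbabilityMeasure (μs n)) [IsProbabilityMeasure μ]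
    (h : Tendsto (fun n => W2sq (μs n) μ) atTop (𝓝 0)) : WeakConv μs μ := by
  let νs : ℕ → ProbabilityMeasure H := fun n => ⟨μs n, hμs n⟩
  let ν : ProbabilityMeasure H := ⟨μ, inferInstance⟩
  suffices Tendsto νs atTop (𝓝 ν) from
    ProbabilityMeasure.tendsto_iff_forall_integral_tendsto.1 this
  rw [tendsto_iff_forall_lipschitz_integral_tendsto]
  rintro f ⟨C, hC⟩ ⟨L, hL⟩
  change Tendsto (fun n => ∫ x, f x ∂(μs n)) atTop (𝓝 (∫ x, f x ∂μ))
  have hfi : ∀ m : Measure H, IsFiniteMeasure m → Integrable f m := fun m _ =>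
    Integrable.of_bound hL.continuous.measurable.aestronglyMeasurable (C + ‖f 0‖)
      (.of_forall fun x => by
        have h1 := hC x 0
        rw [dist_eq_norm] at h1
        linarith [norm_le_norm_sub_add (f x) (f 0)])
  rw [Metric.tendsto_nhds]
  intro ε hε
  set η : ℝ := ε / (2 * (L + 1)) with hη
  have hη0 : 0 < η := by positivity
  filter_upwards [h.eventually_lt_const (ENNReal.ofReal_pos.2 (pow_pos hη0 2))] with n hn
  obtain ⟨P, hP, hlt⟩ : ∃ P, ∃ _ : IsCoupling P (μs n) μ,
      ∫⁻ p, ENNReal.ofReal (‖p.1 - p.2‖ ^ 2) ∂P < ENNReal.ofReal (η ^ 2) := by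
    simpa only [W2sq, iInf_lt_iff] using hn
  have := hP.isProbabilityMeasure_of_right
  have hsq : Integrable (fun p : H × H => ‖p.1 - p.2‖ ^ 2) P := by
    refine (lintegral_ofReal_ne_top_iff_integrable (by fun_prop)
      (.of_forall fun _ => by positivity)).1 (hlt.trans ENNReal.ofReal_lt_top).ne
  have hsq' : ∫ p, ‖p.1 - p.2‖ ^ 2 ∂P < η ^ 2 := by
    rw [← ofReal_integral_eq_lintegral_ofReal hsq (.of_forall fun _ => by positivity)] at hlt
    exact (ENNReal.ofReal_lt_ofReal_iff (by positivity)).1 hlt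
  have e1 : ∫ x, f x ∂(μs n) = ∫ p, f p.1 ∂P := by
    rw [← hP.1, integral_map (by fun_prop) hL.continuous.measurable.aestronglyMeasurable]
  have e2 : ∫ x, f x ∂μ = ∫ p, f p.2 ∂P := by
    rw [← hP.2, integral_map (by fun_prop) hL.continuous.measurable.aestronglyMeasurable]
  have i1 : Integrable (fun p : H × H => f p.1) P := by
    have := hfi (P.map Prod.fst) inferInstance
    exact this.comp_measurable measurable_fst
  have i2 : Integrable (fun p : H × H => f p.2) P := by
    have := hfi (P.map Prod.snd) inferInstance
    exact this.comp_measurable measurable_snd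
  have hi : Integrable (fun p : H × H => (L : ℝ) / (2 * η) * (η ^ 2 + ‖p.1 - p.2‖ ^ 2)) P :=
    ((integrable_const _).add hsq).const_mul _
  rw [e1, e2, Real.dist_eq, ← integral_sub i1 i2]
  calc |∫ p, (f p.1 - f p.2) ∂P| ≤ ∫ p, |f p.1 - f p.2| ∂P := abs_integral_le_integral_abs
    _ ≤ ∫ p, (L : ℝ) / (2 * η) * (η ^ 2 + ‖p.1 - p.2‖ ^ 2) ∂P := by
        refine integral_mono (i1.sub i2).abs hi fun p => ?_
        have h1 := hL.dist_le_mul p.1 p.2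
        rw [Real.dist_eq, dist_eq_norm] at h1
        refine h1.trans ?_
        rw [div_mul_eq_mul_div, le_div_iff₀ (by positivity)]
        nlinarith [mul_nonneg L.coe_nonneg (sq_nonneg (η - ‖p.1 - p.2‖))]
    _ = (L : ℝ) / (2 * η) * (η ^ 2 + ∫ p, ‖p.1 - p.2‖ ^ 2 ∂P) := by
        rw [integral_const_mul, integral_add (integrable_const _) hsq]
        simp
    _ ≤ (L : ℝ) / (2 * η) * (η ^ 2 + η ^ 2) := by gcongr
    _ = L * η := by field_simp; ring
    _ < ε := by
        rw [hη]
        rw [mul_div_assoc', div_lt_iff₀ (by positivity)]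
        nlinarith [L.coe_nonneg]

/-- A lower semicontinuous function whose averages to the right of each point are bounded by its
value there is nonincreasing. -/
theorem le_of_lintegral_Ioc_le {f : ℝ → ℝ≥0∞} {s t : ℝ} (hst : s ≤ t)
    (hf : LowerSemicontinuousOn f (Set.Icc s t))
    (havg : ∀ r ∈ Set.Icc s t, f r < ⊤ →
      ∫⁻ u in Set.Ioc r t, f u ≤ ENNReal.ofReal (t - r) * f r) : f t ≤ f s := by
  by_contra! hlt
  set S : Set ℝ := {r | r ∈ Set.Icc s t ∧ f r ≤ f s} with hS
  have hsS : s ∈ S := ⟨⟨le_rfl, hst⟩, le_rfl⟩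
  have hbdd : BddAbove S := ⟨t, fun r hr => hr.1.2⟩
  set a := sSup S
  have hsa : s ≤ a := le_csSup hbdd hsS
  have hat : a ≤ t := csSup_le ⟨s, hsS⟩ fun r hr => hr.1.2
  have hfa : f a ≤ f s := by
    refine lowerSemicontinuousOn_iff_frequently.1 hf a ⟨hsa, hat⟩ _ ?_
    have h1 := mem_closure_iff_frequently.1 (csSup_mem_closure ⟨s, hsS⟩ hbdd)
    rw [frequently_nhdsWithin_iff]
    exact h1.mono fun r hr => ⟨hr.2, hr.1⟩
  have hgt : ∀ r, a < r → r ≤ t → f s < f r := fun r har hrt => by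
    by_contra! hle
    exact absurd (le_csSup hbdd ⟨⟨hsa.trans har.le, hrt⟩, hle⟩) (not_le.2 har)
  have hat' : a < t := hat.lt_of_ne fun h => absurd (h ▸ hfa) (not_le.2 hlt)
  obtain ⟨c, hsc, hct⟩ := exists_between hlt
  obtain ⟨b, hab, hbt, hb⟩ : ∃ b, a < b ∧ b < t ∧ ∀ r ∈ Set.Ioc b t, c ≤ f r := by
    have h1 := hf t ⟨hst, le_rfl⟩ c hct
    rw [eventually_nhdsWithin_iff, Metric.eventually_nhds_iff] at h1
    obtain ⟨δ, hδ, h2⟩ := h1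
    obtain ⟨b, hb1, hb2⟩ := exists_between (max_lt hat' (sub_lt_self t hδ))
    refine ⟨b, (le_max_left _ _).trans_lt hb1, hb2, fun r hr => (h2 ?_ ?_).le⟩
    · rw [Real.dist_eq, abs_sub_lt_iff]
      constructor <;> linarith [hr.1, hr.2, (le_max_right a (t - δ)).trans_lt hb1]
    · exact ⟨hsa.trans ((le_max_left _ _).trans (hb1.trans hr.1).le), hr.2⟩
  have hint := havg a ⟨hsa, hat⟩ (hfa.trans_lt (hsc.trans_le le_top))
  rw [← Set.Ioc_union_Ioc_eq_Ioc hab.le hbt.le, lintegral_union measurableSet_Ioc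
    (Set.Ioc_disjoint_Ioc_of_le le_rfl)] at hint
  have l1 : ENNReal.ofReal (b - a) * f s ≤ ∫⁻ u in Set.Ioc a b, f u := by
    calc _ = ∫⁻ _ in Set.Ioc a b, f s := by simp [mul_comm]
      _ ≤ _ := setLIntegral_mono' measurableSet_Ioc
        fun u hu => (hgt u hu.1 (hu.2.trans hbt.le)).le
  have l2 : ENNReal.ofReal (t - b) * c ≤ ∫⁻ u in Set.Ioc b t, f u := by
    calc _ = ∫⁻ _ in Set.Ioc b t, c := by simp [mul_comm]
      _ ≤ _ := setLIntegral_mono' measurableSet_Ioc hb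
  have l3 : ENNReal.ofReal (t - a) = ENNReal.ofReal (b - a) + ENNReal.ofReal (t - b) := by
    rw [← ENNReal.ofReal_add (by linarith) (by linarith)]
    congr 1
    ring
  have hs_top : f s ≠ ⊤ := (hsc.trans_le le_top).ne
  have l4 := (add_le_add l1 l2).trans (hint.trans (mul_le_mul_right hfa _))
  rw [l3, add_mul, ENNReal.add_le_add_iff_left (ENNReal.mul_ne_top ENNReal.ofReal_ne_top hs_top),
    ENNReal.mul_le_mul_iff_right (ENNReal.ofReal_pos.2 (by linarith)).ne'
      ENNReal.ofReal_ne_top] at l4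
  exact absurd l4 (not_le.2 hsc)

section RelativeEntropy

open InformationTheory

/-- The relative entropy of probability measures is the Kullback-Leibler divergence. -/
theorem relEnt_eq_klDiv (μ γ : Measure H) [IsProbabilityMeasure μ] [IsProbabilityMeasure γ] :
    relEnt μ γ = klDiv μ γ := by
  by_cases hac : μ ≪ γ
  swap
  · rw [relEnt, if_neg hac, klDiv_of_not_ac hac]
  rw [relEnt, if_pos hac, klDiv_eq_lintegral_klFun_of_ac hac]
  have hmass : ∫⁻ x, ENNReal.ofReal (μ.rnDeriv γ x).toReal ∂γ = 1 := by
    rw [← measure_univ (μ := μ), ← Measure.lintegral_rnDeriv hac]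
    refine lintegral_congr_ae ?_
    filter_upwards [μ.rnDeriv_ne_top γ] with x hx using ENNReal.ofReal_toReal hx
  have key : ∫⁻ x, ENNReal.ofReal ((μ.rnDeriv γ x).toReal * Real.log (μ.rnDeriv γ x).toReal
        + Real.exp (-1)) ∂γ + 1
      = (∫⁻ x, ENNReal.ofReal (klFun (μ.rnDeriv γ x).toReal) ∂γ
          + ENNReal.ofReal (Real.exp (-1))) + 1 := by
    have h1 : ∫⁻ x, (ENNReal.ofReal ((μ.rnDeriv γ x).toReal * Real.log (μ.rnDeriv γ x).toReal
        + Real.exp (-1)) + 1) ∂γ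
      = ∫⁻ x, (ENNReal.ofReal (klFun (μ.rnDeriv γ x).toReal) + ENNReal.ofReal (Real.exp (-1))
          + ENNReal.ofReal (μ.rnDeriv γ x).toReal) ∂γ := by
      refine lintegral_congr fun x => ?_
      set r := (μ.rnDeriv γ x).toReal
      have hr : 0 ≤ r := ENNReal.toReal_nonneg
      have hk := klFun_nonneg hr
      have hpos : 0 ≤ r * Real.log r + Real.exp (-1) := by
        rcases hr.eq_or_lt with h0 | h0
        · simp [← h0, Real.exp_nonneg]
        · have h2 := Real.add_one_le_exp (-1 - Real.log r)
          rw [Real.exp_sub, Real.exp_log h0, le_div_iff₀ h0] at h2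
          nlinarith
      rw [← ENNReal.ofReal_add hk (Real.exp_nonneg _), ← ENNReal.ofReal_add (by positivity) hr,
        ← ENNReal.ofReal_one, ← ENNReal.ofReal_add hpos zero_le_one, klFun_apply]
      congr 1
      ring
    rw [lintegral_add_right _ measurable_const, lintegral_add_right _ (by fun_prop),
      lintegral_add_right _ measurable_const, hmass] at h1
    simpa using h1
  rw [(ENNReal.add_left_inj ENNReal.one_ne_top).1 key,
    ENNReal.add_sub_cancel_right ENNReal.ofReal_ne_top]

/-- The Donsker-Varadhan inequality, in its version without logarithm. -/
theorem integral_le_toReal_klDiv_add {α : Type*} [MeasurableSpace α] {μ γ : Measure α}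
    [IsFiniteMeasure μ] [IsFiniteMeasure γ] (hfin : klDiv μ γ ≠ ⊤) {φ : α → ℝ}
    (hφ : Integrable φ μ) (hexp : Integrable (fun x => Real.exp (φ x)) γ) :
    ∫ x, φ x ∂μ ≤ (klDiv μ γ).toReal + ∫ x, (Real.exp (φ x) - 1) ∂γ := by
  obtain ⟨hac, hint⟩ := klDiv_ne_top_iff.1 hfin
  have hkl := (integrable_klFun_rnDeriv_iff hac).2 hint
  have hexp' : Integrable (fun x => Real.exp (φ x) - 1) γ := hexp.sub (integrable_const 1)
  rw [toReal_klDiv_eq_integral_klFun hac, ← integral_rnDeriv_smul hac,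
    ← integral_add hkl hexp']
  refine integral_mono ((integrable_rnDeriv_smul_iff hac).2 hφ) (hkl.add hexp') fun x => ?_
  have hr : 0 ≤ (μ.rnDeriv γ x).toReal := ENNReal.toReal_nonneg
  simp only [smul_eq_mul, klFun_apply]
  generalize (μ.rnDeriv γ x).toReal = r at *
  rcases hr.eq_or_lt with h0 | h0
  · simp [← h0, Real.exp_nonneg]
  · have h2 := Real.add_one_le_exp (φ x - Real.log r)
    rw [Real.exp_sub, Real.exp_log h0, le_div_iff₀ h0] at h2
    nlinarith

/-- A Donsker-Varadhan bound on bounded continuous functions extends to bounded measurable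
functions. -/
theorem integral_le_of_forall_boundedContinuous {μ γ : Measure H} [IsFiniteMeasure μ]
    [IsFiniteMeasure γ] {c : ℝ}
    (h : ∀ φ : BoundedContinuousFunction H ℝ,
      ∫ x, φ x ∂μ ≤ c + ∫ x, (Real.exp (φ x) - 1) ∂γ)
    {φ : H → ℝ} (hφ : Measurable φ) {M : ℝ} (hM : ∀ x, |φ x| ≤ M) :
    ∫ x, φ x ∂μ ≤ c + ∫ x, (Real.exp (φ x) - 1) ∂γ := by
  have hM0 : 0 ≤ M := (abs_nonneg _).trans (hM 0)
  have hφi : ∀ m : Measure H, IsFiniteMeasure m → Integrable φ m := fun m _ =>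
    Integrable.of_bound hφ.aestronglyMeasurable M (.of_forall hM)
  have hei : ∀ ψ : H → ℝ, Measurable ψ → (∀ x, |ψ x| ≤ M) →
      Integrable (fun x => Real.exp (ψ x) - 1) γ := fun ψ hψ hb =>
    (Integrable.of_bound (hψ.exp.aestronglyMeasurable) (Real.exp M) (.of_forall fun x => by
      rw [Real.norm_eq_abs, Real.abs_exp, Real.exp_le_exp]
      exact (abs_le.1 (hb x)).2)).sub (integrable_const 1)
  refine le_of_forall_pos_le_add fun ε hε => ?_
  set δ := ε / (1 + Real.exp M) with hδ
  have hδ0 : 0 < δ := by positivity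
  obtain ⟨g, hg, -⟩ := (hφi (μ + γ) inferInstance).exists_boundedContinuous_integral_sub_le hδ0
  let g' : BoundedContinuousFunction H ℝ :=
    (g ⊓ BoundedContinuousFunction.const H M) ⊔ BoundedContinuousFunction.const H (-M)
  have hg' : ∀ x, g' x = max (min (g x) M) (-M) := fun x => rfl
  have hg'M : ∀ x, |g' x| ≤ M := fun x => by
    rw [hg', abs_le]
    exact ⟨le_max_right _ _, max_le (min_le_right _ _) (by linarith)⟩
  have hclose : ∀ x, |φ x - g' x| ≤ |φ x - g x| := fun x => by
    obtain ⟨h1, h2⟩ := abs_le.1 (hM x)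
    have : φ x = max (min (φ x) M) (-M) := by
      rw [min_eq_left h2, max_eq_left h1]
    rw [hg']
    conv_lhs => rw [this]
    exact (abs_max_sub_max_le_abs _ _ _).trans (abs_min_sub_min_le_max _ _ _ _ |>.trans (by simp))
  have hdi : ∀ m : Measure H, IsFiniteMeasure m → Integrable (fun x => |φ x - g' x|) m :=
    fun m _ => ((hφi m ‹_›).sub (g'.integrable m)).abs
  have hsum : ∫ x, |φ x - g' x| ∂μ + ∫ x, |φ x - g' x| ∂γ ≤ δ := by
    rw [← integral_add_measure (hdi μ ‹_›) (hdi γ ‹_›)]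
    refine le_trans ?_ hg
    exact integral_mono (hdi _ inferInstance)
      (((hφi _ inferInstance).sub (g.integrable _)).norm) hclose
  have h1 : ∫ x, φ x ∂μ ≤ ∫ x, g' x ∂μ + ∫ x, |φ x - g' x| ∂μ := by
    rw [← integral_add (g'.integrable μ) (hdi μ ‹_›)]
    refine integral_mono (hφi μ ‹_›) ((g'.integrable μ).add (hdi μ ‹_›)) fun x => ?_
    have := le_abs_self (φ x - g' x)
    simp only
    linarith
  have h2 : ∫ x, (Real.exp (g' x) - 1) ∂γ ≤
      ∫ x, (Real.exp (φ x) - 1) ∂γ + Real.exp M * ∫ x, |φ x - g' x| ∂γ := by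
    have hφe := hei φ hφ hM
    rw [← integral_const_mul, ← integral_add hφe ((hdi γ ‹_›).const_mul _)]
    refine integral_mono (hei g' g'.continuous.measurable hg'M)
      (hφe.add ((hdi γ ‹_›).const_mul _)) fun x => ?_
    have e1 := Real.add_one_le_exp (φ x - g' x)
    rw [Real.exp_sub, le_div_iff₀ (Real.exp_pos _)] at e1
    have e2 : Real.exp (g' x) ≤ Real.exp M := Real.exp_le_exp.2 (abs_le.1 (hg'M x)).2
    have e3 := neg_abs_le (φ x - g' x)
    have e4 := abs_nonneg (φ x - g' x)
    have e5 := Real.exp_pos (g' x)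
    simp only
    nlinarith [mul_le_mul_of_nonneg_right e2 e4]
  have h3 := h g'
  have e4 : 0 ≤ ∫ x, |φ x - g' x| ∂μ := integral_nonneg fun _ => abs_nonneg _
  have e5 : 0 ≤ ∫ x, |φ x - g' x| ∂γ := integral_nonneg fun _ => abs_nonneg _
  have e6 : δ * (1 + Real.exp M) = ε := by rw [hδ]; field_simp
  nlinarith [Real.exp_pos M]

/-- The converse of the Donsker-Varadhan inequality. -/
theorem klDiv_le_of_forall_boundedContinuous {μ γ : Measure H} [IsFiniteMeasure μ]
    [IsFiniteMeasure γ] {c : ℝ}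
    (h : ∀ φ : BoundedContinuousFunction H ℝ,
      ∫ x, φ x ∂μ ≤ c + ∫ x, (Real.exp (φ x) - 1) ∂γ) :
    klDiv μ γ ≤ ENNReal.ofReal c := by
  have hac : μ ≪ γ := by
    refine Measure.AbsolutelyContinuous.mk fun s hs hs0 => ?_
    have hk : ∀ k : ℕ, k * μ.real s ≤ c := fun k => by
      have := integral_le_of_forall_boundedContinuous h
        (φ := s.indicator fun _ => (k : ℝ)) (measurable_const.indicator hs) (M := k)
        (fun x => by by_cases hx : x ∈ s <;> simp [hx])
      rw [integral_indicator_const _ hs, smul_eq_mul] at this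
      have h0 : ∫ x, (Real.exp (s.indicator (fun _ => (k : ℝ)) x) - 1) ∂γ = 0 := by
        refine integral_eq_zero_of_ae ?_
        filter_upwards [measure_eq_zero_iff_ae_notMem.1 hs0] with x hx
        simp [hx]
      linarith
    by_contra hne
    have hpos : 0 < μ.real s := ENNReal.toReal_pos hne (measure_ne_top _ _)
    obtain ⟨k, hk'⟩ := exists_nat_gt (c / μ.real s)
    rw [div_lt_iff₀ hpos] at hk'
    exact absurd (hk k) (not_le.2 hk')
  rw [klDiv_eq_lintegral_klFun_of_ac hac]
  let ρ : H → ℝ := fun x => (μ.rnDeriv γ x).toReal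
  have hρ : Measurable ρ := by fun_prop
  have hρ0 : ∀ x, 0 ≤ ρ x := fun x => ENNReal.toReal_nonneg
  let r : ℕ → H → ℝ := fun k x => min (max (ρ x) (Real.exp (-k))) (Real.exp k)
  have hr : ∀ k, Measurable (r k) := fun k => by fun_prop
  have hr0 : ∀ k x, 0 < r k x := fun k x =>
    lt_min (lt_max_of_lt_right (Real.exp_pos _)) (Real.exp_pos _)
  have hexple : ∀ k : ℕ, Real.exp (-(k : ℝ)) ≤ Real.exp k := fun k =>
    Real.exp_le_exp.2 (by linarith [k.cast_nonneg (α := ℝ)])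
  have hrl : ∀ (k : ℕ) x, Real.exp (-(k : ℝ)) ≤ r k x := fun k x => le_min (le_max_right _ _) (hexple k)
  have hlog : ∀ k x, |Real.log (r k x)| ≤ k := fun k x => by
    rw [abs_le]
    exact ⟨(Real.le_log_iff_exp_le (hr0 k x)).2 (hrl k x),
      (Real.log_le_iff_le_exp (hr0 k x)).2 (min_le_right _ _)⟩
  have hnonneg : ∀ k x, 0 ≤ ρ x * Real.log (r k x) - (r k x - 1) := fun k x => by
    have h1 := klFun_nonneg (hr0 k x).le
    rw [klFun_apply] at h1
    have h2 : 0 ≤ (ρ x - r k x) * Real.log (r k x) := by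
      rcases le_total (Real.exp k) (ρ x) with h3 | h3
      · have h4 : r k x = Real.exp k := min_eq_right (h3.trans (le_max_left _ _))
        rw [h4, Real.log_exp]
        exact mul_nonneg (by linarith) k.cast_nonneg
      rcases le_total (ρ x) (Real.exp (-k)) with h5 | h5
      · have h4 : r k x = Real.exp (-k) := by
          change min (max (ρ x) (Real.exp (-k))) (Real.exp k) = _
          rw [max_eq_right h5, min_eq_left (hexple k)]
        rw [h4, Real.log_exp]
        nlinarith [k.cast_nonneg (α := ℝ)]
      · have h4 : r k x = ρ x := by
          change min (max (ρ x) (Real.exp (-k))) (Real.exp k) = _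
          rw [max_eq_left h5, min_eq_left h3]
        simp [h4]
    linarith
  have hlim : ∀ x, Tendsto (fun k : ℕ => ρ x * Real.log (r k x) - (r k x - 1)) atTop
      (𝓝 (klFun (ρ x))) := fun x => by
    have hrlim : Tendsto (fun k : ℕ => r k x) atTop (𝓝 (ρ x)) := by
      have h1 : Tendsto (fun k : ℕ => max (ρ x) (Real.exp (-k))) atTop (𝓝 (max (ρ x) 0)) :=
        tendsto_const_nhds.max
          (Real.tendsto_exp_neg_atTop_nhds_zero.comp tendsto_natCast_atTop_atTop)
      rw [max_eq_left (hρ0 x)] at h1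
      have h2 : ∀ᶠ k : ℕ in atTop, max (ρ x) (Real.exp (-k)) = r k x := by
        have h3 := (Real.tendsto_exp_atTop.comp
          (tendsto_natCast_atTop_atTop (R := ℝ))).eventually_ge_atTop (ρ x)
        filter_upwards [h3] with k hk
        exact (min_eq_left (max_le hk (hexple k))).symm
      exact h1.congr' h2
    rw [show klFun (ρ x) = ρ x * Real.log (ρ x) - (ρ x - 1) by rw [klFun_apply]; ring]
    refine Tendsto.sub ?_ (hrlim.sub_const 1)
    rcases eq_or_ne (ρ x) 0 with h0 | h0
    · simp [h0]
    · exact (hrlim.log h0).const_mul _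
  have hbound : ∀ k, ∫⁻ x, ENNReal.ofReal (ρ x * Real.log (r k x) - (r k x - 1)) ∂γ
      ≤ ENNReal.ofReal c := fun k => by
    have hlm : Measurable fun x => Real.log (r k x) := (hr k).log
    have hi1 : Integrable (fun x => ρ x * Real.log (r k x)) γ :=
      (integrable_rnDeriv_smul_iff hac).2
        (Integrable.of_bound hlm.aestronglyMeasurable k (.of_forall (hlog k)))
    have hi2 : Integrable (fun x => r k x - 1) γ :=
      (Integrable.of_bound (hr k).aestronglyMeasurable (Real.exp k) (.of_forall fun x => by
        rw [Real.norm_eq_abs, abs_of_pos (hr0 k x)]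
        exact min_le_right _ _)).sub (integrable_const 1)
    have hi : Integrable (fun x => ρ x * Real.log (r k x) - (r k x - 1)) γ := hi1.sub hi2
    rw [← ofReal_integral_eq_lintegral_ofReal hi (.of_forall (hnonneg k))]
    refine ENNReal.ofReal_le_ofReal ?_
    have h1 := integral_le_of_forall_boundedContinuous h hlm (hlog k)
    simp only [Real.exp_log (hr0 k _)] at h1
    rw [← integral_rnDeriv_smul hac] at h1
    rw [integral_sub hi1 hi2]
    simp only [smul_eq_mul] at h1
    linarith
  calc ∫⁻ x, ENNReal.ofReal (klFun (ρ x)) ∂γ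
      = ∫⁻ x, liminf (fun k : ℕ => ENNReal.ofReal (ρ x * Real.log (r k x) - (r k x - 1))) atTop ∂γ :=
        lintegral_congr fun x => ((ENNReal.tendsto_ofReal (hlim x)).liminf_eq).symm
    _ ≤ liminf (fun k : ℕ => ∫⁻ x, ENNReal.ofReal (ρ x * Real.log (r k x) - (r k x - 1)) ∂γ) atTop :=
        lintegral_liminf_le fun k =>
          ((hρ.mul (hr k).log).sub ((hr k).sub_const 1)).ennreal_ofReal
    _ ≤ ENNReal.ofReal c :=
        (liminf_le_liminf (.of_forall hbound)).trans_eq (by simp)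

/-- Relative entropy is sequentially lower semicontinuous in the Wasserstein distance. -/
theorem relEnt_le_of_tendsto_W2sq {μs : ℕ → Measure H} {μ γ : Measure H}
    (hμs : ∀ n, IsProbabilityMeasure (μs n)) [IsProbabilityMeasure μ] [IsProbabilityMeasure γ]
    (h : Tendsto (fun n => W2sq (μs n) μ) atTop (𝓝 0)) {c : ℝ≥0∞}
    (hc : ∀ n, relEnt (μs n) γ ≤ c) : relEnt μ γ ≤ c := by
  rcases eq_or_ne c ⊤ with rfl | hctop
  · exact le_top
  rw [relEnt_eq_klDiv, ← ENNReal.ofReal_toReal hctop]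
  refine klDiv_le_of_forall_boundedContinuous fun φ => ?_
  refine le_of_tendsto (weakConv_of_tendsto_W2sq hμs h φ) (.of_forall fun n => ?_)
  have := hμs n
  have hn := hc n
  rw [relEnt_eq_klDiv] at hn
  have hexp : Integrable (fun x => Real.exp (φ x)) γ :=
    Integrable.of_bound (by fun_prop) (Real.exp ‖φ‖) (.of_forall fun x => by
      rw [Real.norm_eq_abs, Real.abs_exp, Real.exp_le_exp]
      exact (le_abs_self _).trans (φ.norm_coe_le_norm x))
  refine (integral_le_toReal_klDiv_add (hn.trans_lt hctop.lt_top).ne (φ.integrable _) hexp).trans ?_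
  gcongr

theorem relEnt_self (γ : Measure H) [IsProbabilityMeasure γ] : relEnt γ γ = 0 := by
  rw [relEnt_eq_klDiv, klDiv_self]

end RelativeEntropy

/-- Along a gradient flow of the relative entropy, the entropy is lower semicontinuous in time. -/
theorem IsGradientFlow.lowerSemicontinuousOn_relEnt {γ : Measure H} [IsProbabilityMeasure γ]
    {μ : ℝ → Measure H} (hgf : IsGradientFlow (fun ν => relEnt ν γ) μ) :
    LowerSemicontinuousOn (fun t => relEnt (μ t) γ) (Set.Ioi 0) := by
  obtain ⟨hP2, hcont, -⟩ := hgf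
  refine lowerSemicontinuousOn_iff_frequently.2 fun t ht c hfreq => ?_
  obtain ⟨u, hu, hu'⟩ := exists_seq_forall_of_frequently
    (hfreq.and_eventually self_mem_nhdsWithin)
  have := (hP2 t ht).1
  exact relEnt_le_of_tendsto_W2sq (fun n => (hP2 _ (hu' n).2).1) ((hcont t ht).comp hu)
    fun n => (hu' n).1

/-- Along a gradient flow of the relative entropy, the entropy is nonincreasing in time. -/
theorem IsGradientFlow.relEnt_antitoneOn {γ : Measure H} [IsProbabilityMeasure γ]
    {μ : ℝ → Measure H} (hgf : IsGradientFlow (fun ν => relEnt ν γ) μ) :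
    AntitoneOn (fun t => relEnt (μ t) γ) (Set.Ioi 0) := fun s hs t _ hst => by
  refine le_of_lintegral_Ioc_le (f := fun t => relEnt (μ t) γ) hst
    (hgf.lowerSemicontinuousOn_relEnt.mono fun r hr => hs.trans_le hr.1) fun r hr hfin => ?_
  have hr0 : 0 < r := hs.trans_le hr.1
  have h := hgf.2.2 (μ r) (hgf.1 r hr0) hfin r t hr0 hr.2
  rw [W2sq_self, ENNReal.zero_div, zero_add] at h
  exact le_add_self.trans h

/-- The regularizing estimate for the entropy flow, against a single competitor. -/
theorem IsGradientFlow.relEnt_le {γ : Measure H} [IsProbabilityMeasure γ]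
    {μ : ℝ → Measure H} (hgf : IsGradientFlow (fun ν => relEnt ν γ) μ)
    {μbar : Measure H} [IsProbabilityMeasure μbar] (hstart : StartsFrom μ μbar)
    {ν : Measure H} (hν : MemP2 ν) (hfin : relEnt ν γ < ⊤) {t : ℝ} (ht : 0 < t) :
    relEnt (μ t) γ ≤ (ENNReal.ofReal (2 * t))⁻¹ * W2sq μbar ν + relEnt ν γ := by
  have hEVI : ∀ s, 0 < s → s ≤ t → ENNReal.ofReal (t - s) * relEnt (μ t) γ ≤
      W2sq (μ s) ν / 2 + ENNReal.ofReal (t - s) * relEnt ν γ := fun s hs hst =>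
    calc ENNReal.ofReal (t - s) * relEnt (μ t) γ = ∫⁻ _ in Set.Ioc s t, relEnt (μ t) γ := by
          simp [mul_comm]
      _ ≤ ∫⁻ r in Set.Ioc s t, relEnt (μ r) γ :=
          setLIntegral_mono' measurableSet_Ioc fun r hr =>
            hgf.relEnt_antitoneOn (hs.trans hr.1) ht hr.2
      _ ≤ _ := le_add_self.trans (hgf.2.2 ν hν hfin s t hs hst)
  have hlimt : Tendsto (fun s : ℝ => ENNReal.ofReal (t - s)) (𝓝[>] 0) (𝓝 (ENNReal.ofReal t)) := by
    have : Tendsto (fun s : ℝ => t - s) (𝓝[>] 0) (𝓝 (t - 0)) :=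
      ((continuous_const.sub continuous_id).tendsto 0).mono_left nhdsWithin_le_nhds
    rw [sub_zero] at this
    exact ENNReal.tendsto_ofReal this
  have ht0 : ENNReal.ofReal t ≠ 0 := (ENNReal.ofReal_pos.2 ht).ne'
  have hε : ∀ ε : ℝ, 0 < ε → ENNReal.ofReal t * relEnt (μ t) γ ≤
      ENNReal.ofReal (1 + ε) * W2sq μbar ν / 2 + ENNReal.ofReal t * relEnt ν γ := fun ε hε => by
    have hR : Tendsto (fun s => (ENNReal.ofReal (1 + ε) * W2sq μbar ν
        + ENNReal.ofReal (1 + ε⁻¹) * W2sq (μ s) μbar) / 2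
        + ENNReal.ofReal (t - s) * relEnt ν γ) (𝓝[>] 0)
        (𝓝 ((ENNReal.ofReal (1 + ε) * W2sq μbar ν + ENNReal.ofReal (1 + ε⁻¹) * 0) / 2
          + ENNReal.ofReal t * relEnt ν γ)) :=
      (ENNReal.Tendsto.div_const (tendsto_const_nhds.add
        (ENNReal.Tendsto.const_mul hstart (.inr ENNReal.ofReal_ne_top))) (.inr two_ne_zero)).add
        (ENNReal.Tendsto.mul_const hlimt (.inl ht0))
    rw [mul_zero, add_zero] at hR
    refine le_of_tendsto_of_tendsto (ENNReal.Tendsto.mul_const hlimt (.inl ht0)) hR ?_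
    filter_upwards [Ioc_mem_nhdsGT ht] with s hs
    refine (hEVI s hs.1 hs.2).trans ?_
    gcongr
    exact W2sq_le_add hε
  have hmain : ENNReal.ofReal t * relEnt (μ t) γ ≤
      W2sq μbar ν / 2 + ENNReal.ofReal t * relEnt ν γ := by
    have h1 : Tendsto (fun ε : ℝ => ENNReal.ofReal (1 + ε)) (𝓝[>] 0) (𝓝 1) := by
      have : Tendsto (fun ε : ℝ => 1 + ε) (𝓝[>] 0) (𝓝 (1 + 0)) :=
        ((continuous_const.add continuous_id).tendsto 0).mono_left nhdsWithin_le_nhds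
      rw [add_zero] at this
      simpa using ENNReal.tendsto_ofReal this
    have h2 := (ENNReal.Tendsto.div_const (ENNReal.Tendsto.mul_const (b := W2sq μbar ν) h1
      (.inl one_ne_zero)) (.inr (two_ne_zero))).add_const (ENNReal.ofReal t * relEnt ν γ)
    rw [one_mul] at h2
    exact ge_of_tendsto h2 (by filter_upwards [self_mem_nhdsWithin] with ε h using hε ε h)
  rw [← ENNReal.mul_le_mul_iff_right ht0 ENNReal.ofReal_ne_top]
  refine hmain.trans_eq ?_
  rw [mul_add, ENNReal.ofReal_mul zero_le_two, ENNReal.mul_inv (by simp) (by simp), ← mul_assoc,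
    mul_left_comm, ENNReal.mul_inv_cancel ht0 ENNReal.ofReal_ne_top, mul_one, div_eq_mul_inv,
    mul_comm (W2sq μbar ν)]
  simp

/-- Regularizing effect of the entropy gradient flow: if `μ` is the gradient flow of
`F = H(·|γ)` starting from `μ̄` in the `W₂`-closure of `D(F)`, then for every `t > 0`,
`F(μ_t) ≤ inf_{ν ∈ D(F)} { W₂²(μ̄,ν)/(2t) + F(ν) } < ∞`; in particular, if
`γ ∈ P₂(H)`, then `H(μ_t|γ) ≤ W₂²(μ̄,γ)/(2t)` (applied with `μ̄ = δ_x` this gives the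
estimate for the flow started at a point `x` of the support of `γ`). -/
theorem entropy_flow_regularizing (γ : Measure H)
    (hγ : IsProbabilityMeasure γ) (hlc : IsLogConcave γ)
    (μ : ℝ → Measure H) (μbar : Measure H) (hμbar : MemP2 μbar)
    (hgf : IsGradientFlow (fun ν => relEnt ν γ) μ) (hstart : StartsFrom μ μbar)
    (hclos : ∀ ε : ℝ, 0 < ε → ∃ ν : Measure H,
      MemP2 ν ∧ relEnt ν γ < ⊤ ∧ W2sq ν μbar ≤ ENNReal.ofReal ε) :
    ∀ t : ℝ, 0 < t →
      (relEnt (μ t) γ ≤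
        ⨅ (ν : Measure H) (_ : MemP2 ν ∧ relEnt ν γ < ⊤),
          ((ENNReal.ofReal (2 * t))⁻¹ * W2sq μbar ν + relEnt ν γ)) ∧
      (⨅ (ν : Measure H) (_ : MemP2 ν ∧ relEnt ν γ < ⊤),
          ((ENNReal.ofReal (2 * t))⁻¹ * W2sq μbar ν + relEnt ν γ)) < ⊤ ∧
      (MemP2 γ → relEnt (μ t) γ ≤ (ENNReal.ofReal (2 * t))⁻¹ * W2sq μbar γ) := by
  intro t ht
  have := hμbar.1
  refine ⟨le_iInf₂ fun ν hν => hgf.relEnt_le hstart hν.1 hν.2 ht, ?_, fun hγ2 => ?_⟩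
  · obtain ⟨ν, hν, hfin, hW⟩ := hclos 1 one_pos
    refine (iInf₂_le ν ⟨hν, hfin⟩).trans_lt (ENNReal.add_lt_top.2 ⟨ENNReal.mul_lt_top ?_ ?_, hfin⟩)
    · exact ENNReal.inv_lt_top.2 (ENNReal.ofReal_pos.2 (by positivity))
    · rw [W2sq_comm]
      exact hW.trans_lt ENNReal.ofReal_lt_top
  · have h := hgf.relEnt_le hstart hγ2 (by simp [relEnt_self]) ht
    rwa [relEnt_self, add_zero] at h
end
end
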